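/- Let X be a smooth projective curve over an algebraically closed field k, and let u be a nontrivial automorphism of X having r fixed points. If there exists a finite morphism f : X → P^1 of degree d such that u∘f ≠ f (i.e., the pullback u*f is not equal to f as a rational function), then r ≤ 2d. -/

import Mathlib

open Polynomial IntermediateField
open scoped Polynomial.Bivariate


theorem fin_lem {k K : Type*} [Field k] [Field K] [Algebra k K]
    {t : K} (ht : ¬ IsAlgebraic k t) (hfd : FiniteDimensional k⟮t⟯ K)
    {y : K} (hy : ¬ IsAlgebraic k y) : FiniteDimensional k⟮y⟯ K := by
  have halg : IsAlgebraic k⟮y⟯ t :=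
    IntermediateField.isAlgebraic_adjoin_iff.mpr (.adjoin_singleton ht hy
      (IntermediateField.isAlgebraic_adjoin_iff.mp (Algebra.IsAlgebraic.isAlgebraic y)))
  let Fyx := restrictScalars k k⟮y⟯⟮t⟯
  let Fxy := restrictScalars k k⟮t⟯⟮y⟯
  let : Algebra k⟮y⟯ Fyx := k⟮y⟯⟮t⟯.algebra
  let : Module k⟮y⟯ Fyx := Algebra.toModule
  let : SMul k⟮y⟯ Fyx := Algebra.toSMul
  let : Algebra k⟮t⟯ Fxy := k⟮t⟯⟮y⟯.algebra
  let : Module k⟮t⟯ Fxy := Algebra.toModule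
  let : SMul k⟮t⟯ Fxy := Algebra.toSMul
  have : FiniteDimensional k⟮y⟯ Fyx :=
    adjoin.finiteDimensional (isAlgebraic_iff_isIntegral.mp halg)
  have : FiniteDimensional Fyx K := by
    unfold Fyx
    rw [adjoin_simple_comm]
    have : IsScalarTower k⟮t⟯ Fxy K := isScalarTower_mid' k⟮t⟯⟮y⟯
    exact .right k⟮t⟯ Fxy K
  have : IsScalarTower k⟮y⟯ Fyx K := isScalarTower_mid' k⟮y⟯⟮t⟯
  exact .trans k⟮y⟯ Fyx K

/-- `k[X] → k(y)` -/
noncomputable abbrev polyAlg {k K : Type*} [Field k] [Field K] [Algebra k K] (y : K) :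
    Algebra k[X] k⟮y⟯ := (aeval (AdjoinSimple.gen k y)).toAlgebra

theorem polyAlg_apply {k K : Type*} [Field k] [Field K] [Algebra k K] (y : K) (p : k[X]) :
    letI := polyAlg (k := k) y
    ((algebraMap k[X] k⟮y⟯ p : k⟮y⟯) : K) = aeval y p := by
  let := polyAlg (k := k) y
  change ((aeval (AdjoinSimple.gen k y) p : k⟮y⟯) : K) = aeval y p
  rw [← IntermediateField.aeval_coe]; rfl

theorem polyAlg_frac {k K : Type*} [Field k] [Field K] [Algebra k K] {y : K}
    (hy : ¬ IsAlgebraic k y) :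
    letI := polyAlg (k := k) y
    IsFractionRing k[X] k⟮y⟯ := by
  let := polyAlg (k := k) y
  have hinj : Function.Injective (algebraMap k[X] k⟮y⟯) := by
    rw [injective_iff_map_eq_zero]
    intro p hp
    by_contra h0
    exact hy ⟨p, h0, by rw [← polyAlg_apply, hp]; rfl⟩
  have : FaithfulSMul k[X] k⟮y⟯ := (faithfulSMul_iff_algebraMap_injective _ _).2 hinj
  refine IsFractionRing.of_field _ _ ?_
  rintro ⟨z, hz⟩
  obtain ⟨r, s, h⟩ := (mem_adjoin_simple_iff k z).1 hz
  refine ⟨r, s, ?_⟩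
  apply Subtype.ext
  refine h.trans ?_
  rw [← polyAlg_apply, ← polyAlg_apply]
  rfl

theorem mapPoly_aeval {k K : Type*} [Field k] [Field K] [Algebra k K] (a b : K) (P : k[X][Y]) :
    letI := polyAlg (k := k) a
    aeval b (P.map (algebraMap k[X] k⟮a⟯)) = aevalAeval a b P := by
  let := polyAlg (k := k) a
  induction P using Polynomial.induction_on' with
  | add p q hp hq => simp only [Polynomial.map_add, map_add, hp, hq]
  | monomial n p =>
    have := polyAlg_apply a p
    rw [Polynomial.map_monomial, aeval_monomial, ← C_mul_X_pow_eq_monomial]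
    simp only [map_mul, map_pow]
    rw [show (algebraMap k⟮a⟯ K) (algebraMap k[X] k⟮a⟯ p) = aeval a p from this]
    simp

theorem degC {k K : Type*} [Field k] [Field K] [Algebra k K] {a b : K}
    (ha : ¬ IsAlgebraic k a) {Q : k[X][Y]} (hQ : Q ≠ 0) (h0 : aevalAeval a b Q = 0) :
    Module.finrank k⟮a⟯ k⟮a⟯⟮b⟯ ≤ Q.natDegree := by
  let := polyAlg (k := k) a
  have := polyAlg_frac ha
  have hQ' : Q.map (algebraMap k[X] k⟮a⟯) ≠ 0 :=
    (Polynomial.map_ne_zero_iff (IsFractionRing.injective k[X] k⟮a⟯)).2 hQ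
  have h0' : aeval b (Q.map (algebraMap k[X] k⟮a⟯)) = 0 := by rw [mapPoly_aeval, h0]
  have hi : IsIntegral k⟮a⟯ b := isAlgebraic_iff_isIntegral.1 ⟨_, hQ', h0'⟩
  rw [adjoin.finrank hi]
  exact (natDegree_le_of_dvd (minpoly.dvd _ _ h0') hQ').trans natDegree_map_le

theorem degB {k K : Type*} [Field k] [Field K] [Algebra k K] {a b : K}
    (ha : ¬ IsAlgebraic k a) {Q : k[X][Y]} (hQ : Irreducible Q) (h0 : aevalAeval a b Q = 0) :
    Module.finrank k⟮a⟯ k⟮a⟯⟮b⟯ = Q.natDegree := by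
  let := polyAlg (k := k) a
  have := polyAlg_frac ha
  have hd : Q.natDegree ≠ 0 := by
    intro hd
    rw [natDegree_eq_zero] at hd
    obtain ⟨p, rfl⟩ := hd
    apply ha
    refine ⟨p, ?_, by simpa using h0⟩
    rintro rfl
    exact hQ.ne_zero (by simp)
  have hQ' : Irreducible (Q.map (algebraMap k[X] k⟮a⟯)) :=
    ((hQ.isPrimitive hd).irreducible_iff_irreducible_map_fraction_map).1 hQ
  have h0' : aeval b (Q.map (algebraMap k[X] k⟮a⟯)) = 0 := by rw [mapPoly_aeval, h0]
  have hi : IsIntegral k⟮a⟯ b := isAlgebraic_iff_isIntegral.1 ⟨_, hQ'.ne_zero, h0'⟩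
  rw [adjoin.finrank hi, ← minpoly.eq_of_irreducible hQ' h0', natDegree_mul_C,
    natDegree_map_eq_of_injective (IsFractionRing.injective k[X] k⟮a⟯)]
  exact inv_ne_zero (leadingCoeff_ne_zero.2 hQ'.ne_zero)

theorem exP {k K : Type*} [Field k] [Field K] [Algebra k K] {a b : K}
    (ha : ¬ IsAlgebraic k a) (hb : IsAlgebraic k⟮a⟯ b) :
    ∃ P : k[X][Y], Irreducible P ∧ aevalAeval a b P = 0 := by
  let := polyAlg (k := k) a
  have := polyAlg_frac ha
  have hne : ∃ Q : k[X][Y], Q ≠ 0 ∧ aevalAeval a b Q = 0 := by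
    let : Algebra k[X] K := (aeval a).toAlgebra
    have : IsScalarTower k[X] k⟮a⟯ K := IsScalarTower.of_algebraMap_eq fun p => by
      exact (polyAlg_apply a p).symm
    obtain ⟨Q, h1, h2⟩ := (IsFractionRing.isAlgebraic_iff k[X] k⟮a⟯ K).2 hb
    refine ⟨Q, h1, ?_⟩
    rw [← mapPoly_aeval, aeval_map_algebraMap, h2]
  obtain ⟨Q, hQ, hQ0⟩ := hne
  have hp : (RingHom.ker (aevalAeval (R := k) a b)).IsPrime := RingHom.ker_isPrime _
  obtain ⟨P, hP, hP'⟩ := hp.exists_mem_prime_of_ne_bot (by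
    intro h
    have : Q ∈ RingHom.ker (aevalAeval (R := k) a b) := hQ0
    rw [h] at this
    exact hQ this)
  exact ⟨P, hP'.irreducible, hP⟩

theorem tower {k K : Type*} [Field k] [Field K] [Algebra k K] (a b : K) :
    Module.finrank k⟮a⟯ K =
      Module.finrank k⟮a⟯ k⟮a⟯⟮b⟯ * Module.finrank (adjoin k {a, b}) K := by
  have h : k⟮a⟯ ≤ adjoin k {a, b} := adjoin.mono _ _ _ (by simp)
  rw [← relfinrank_mul_finrank_top h, relfinrank_eq_finrank_of_le h]
  congr 1
  have : extendScalars h = k⟮a⟯⟮b⟯ := by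
    rw [extendScalars_adjoin]
    apply le_antisymm
    · rw [adjoin_le_iff]
      rintro x (rfl | rfl)
      · exact (k⟮x⟯⟮b⟯).algebraMap_mem (AdjoinSimple.gen k x)
      · exact mem_adjoin_simple_self _ _
    · exact adjoin.mono _ _ _ (by simp)
  rw [this]

theorem coeff_swap {k : Type*} [Field k] (P : k[X][Y]) (i j : ℕ) :
    ((Bivariate.swap P).coeff i).coeff j = (P.coeff j).coeff i := by
  induction P using Polynomial.induction_on' with
  | add p q hp hq => simp only [map_add, coeff_add, hp, hq]
  | monomial n p =>
    induction p using Polynomial.induction_on' with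
    | add p q hp hq => simp only [map_add, coeff_add, hp, hq]
    | monomial m r =>
      rw [Bivariate.swap_monomial_monomial]
      simp only [coeff_monomial]
      split_ifs <;> simp_all [coeff_monomial]

theorem deg_sub {k K : Type*} [Field k] [Field K] [Algebra k K] {a b : K}
    (ha : ¬ IsAlgebraic k a) (hb : ¬ IsAlgebraic k b) (hg : ¬ IsAlgebraic k (b - a))
    (hab : IsAlgebraic k⟮a⟯ b) :
    Module.finrank k⟮b - a⟯ K ≤ Module.finrank k⟮a⟯ K + Module.finrank k⟮b⟯ K := by
  obtain ⟨P, hP, hP0⟩ := exP ha hab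
  have hP2 : Irreducible (Bivariate.swap P) := (MulEquiv.irreducible_iff Bivariate.swap).2 hP
  have h1 := degB ha hP hP0
  have h2 := degB hb hP2 (by rw [Bivariate.aevalAeval_swap, hP0])
  set Q : k[X][Y] := aevalAeval (A := k[X][Y]) Y (Y + C X) P with hQ
  have hQP : aevalAeval (A := k[X][Y]) (Y - C X) (C X) Q = P := by
    have : ((aevalAeval (A := k[X][Y]) (Y - C X) (C X)).comp
        (aevalAeval (A := k[X][Y]) Y (Y + C X))) = AlgHom.id k _ := by
      ext <;> simp
    exact DFunLike.congr_fun this P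
  have hQ0 : Q ≠ 0 := by
    intro h
    rw [h, map_zero] at hQP
    exact hP.ne_zero hQP.symm
  have hQe : aevalAeval (b - a) a Q = 0 := by
    have : ((aevalAeval (R := k) (b - a) a).comp
        (aevalAeval (A := k[X][Y]) Y (Y + C X))) = aevalAeval a b := by
      ext <;> simp
    rw [← hP0, ← this]; rfl
  have h3 := degC hg hQ0 hQe
  have h4 : Q.natDegree ≤ P.natDegree + (Bivariate.swap P).natDegree := by
    have hQs : Q = ∑ j ∈ Finset.range (P.natDegree + 1),
        ((P.coeff j).map C) * (Y + C X) ^ j := by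
      conv_lhs => rw [hQ, P.as_sum_range_C_mul_X_pow]
      rw [map_sum]
      refine Finset.sum_congr rfl fun j _ => ?_
      simp [← Bivariate.swap_C, Bivariate.swap_apply]
    rw [hQs]
    refine natDegree_sum_le_of_forall_le _ _ fun j hj => ?_
    rw [Finset.mem_range] at hj
    have e1 : ((P.coeff j).map (C : k →+* k[X])).natDegree ≤ (Bivariate.swap P).natDegree := by
      refine natDegree_map_le.trans ?_
      rw [natDegree_le_iff_coeff_eq_zero]
      intro N hN
      rw [← coeff_swap, coeff_eq_zero_of_natDegree_lt hN, coeff_zero]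
    have e2 : ((Y + C X : k[X][Y]) ^ j).natDegree ≤ j := by
      refine natDegree_pow_le.trans ?_
      rw [natDegree_X_add_C, mul_one]
    refine natDegree_mul_le.trans ?_
    omega
  rw [tower a b, tower b a, tower (b - a) a, h1, h2, Set.pair_comm b a]
  have : adjoin k {b - a, a} = adjoin k {a, b} := by
    apply le_antisymm
    · rw [adjoin_le_iff]
      have ma : a ∈ adjoin k {a, b} := subset_adjoin _ _ (by simp)
      have mb : b ∈ adjoin k {a, b} := subset_adjoin _ _ (by simp)
      rintro x (rfl | rfl)
      · exact sub_mem mb ma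
      · exact ma
    · rw [adjoin_le_iff]
      have ma : a ∈ adjoin k {b - a, a} := subset_adjoin _ _ (by simp)
      have mb : b - a ∈ adjoin k {b - a, a} := subset_adjoin _ _ (by simp)
      rintro x (rfl | rfl)
      · exact ma
      · simpa using add_mem mb ma
  rw [this, ← add_mul]
  exact Nat.mul_le_mul_right _ (h3.trans h4)

theorem finrank_aut {k K : Type*} [Field k] [Field K] [Algebra k K] (u : K ≃ₐ[k] K) (f : K) :
    Module.finrank k⟮u f⟯ K = Module.finrank k⟮f⟯ K := by
  have := relfinrank_map_map k⟮f⟯ ⊤ (u : K →ₐ[k] K)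
  rw [adjoin_map, Set.image_singleton, ← AlgHom.fieldRange_eq_map, AlgHom.fieldRange_eq_top.2 u.surjective,
    relfinrank_top_right, relfinrank_top_right] at this
  exact this

section places
variable {k K : Type*} [Field k] [Field K] [Algebra k K]

/-- a `k`-place of `K` -/
def IsPl (k : Type*) {K : Type*} [Field k] [Field K] [Algebra k K] (v : ValuationSubring K) : Prop :=
  (∀ c : k, algebraMap k K c ∈ v) ∧ (v : Set K) ≠ Set.univ

theorem IsPl.const {v : ValuationSubring K} (hv : IsPl k v) {c : k} (hc : c ≠ 0) :
    v.valuation (algebraMap k K c) = 1 := by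
  apply le_antisymm
  · exact (v.valuation_le_one_iff _).2 (hv.1 c)
  · have := (v.valuation_le_one_iff _).2 (hv.1 c⁻¹)
    rw [map_inv₀, map_inv₀] at this
    rwa [inv_le_one₀] at this
    rw [zero_lt_iff, Valuation.ne_zero_iff]
    simpa using hc

theorem IsPl.uniq {v : ValuationSubring K} (hv : IsPl k v) {x : K} {c c' : k}
    (h : v.valuation (x - algebraMap k K c) < 1) (h' : v.valuation (x - algebraMap k K c') < 1) :
    c = c' := by
  by_contra hne
  have := hv.const (sub_ne_zero.2 hne)
  have h2 := Valuation.map_sub_lt _ h' h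
  rw [sub_sub_sub_cancel_left, ← map_sub, this] at h2
  exact lt_irrefl _ h2

theorem lt_one_iff_inv (v : ValuationSubring K) (x : K) :
    v.valuation x < 1 ↔ ¬ (x ≠ 0 ∧ x⁻¹ ∈ v) := by
  rw [← not_le, not_iff_not, ← v.valuation_le_one_iff, map_inv₀]
  constructor
  · intro h
    have h0 : x ≠ 0 := by
      rintro rfl
      simp at h
    refine ⟨h0, inv_le_one_of_one_le₀ h⟩
  · rintro ⟨h0, h⟩
    rwa [inv_le_one₀] at h
    rw [zero_lt_iff, Valuation.ne_zero_iff]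
    exact h0

theorem inv_mem_of_not_lt (v : ValuationSubring K) {x : K} (h : ¬ v.valuation x < 1) :
    x⁻¹ ∈ v := by
  rw [lt_one_iff_inv, not_not] at h
  exact h.2

theorem IsPl.res [IsAlgClosed k]
    (hconst : ∀ x : K, IsAlgebraic k x → x ∈ (algebraMap k K).range)
    (hfin : ∀ y : K, ¬ IsAlgebraic k y → FiniteDimensional k⟮y⟯ K)
    {v : ValuationSubring K} (hv : IsPl k v) {x : K} (hx : x ∈ v) :
    ∃ c : k, v.valuation (x - algebraMap k K c) < 1 := by
  by_cases hxa : IsAlgebraic k x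
  · obtain ⟨c, rfl⟩ := hconst x hxa
    exact ⟨c, by simp⟩
  by_contra! hno
  have hfx := hfin x hxa
  have hmem : ∀ p : k[X], aeval x p ∈ v := fun p => by
    rw [aeval_eq_sum_range]
    refine sum_mem fun i _ => ?_
    rw [Algebra.smul_def]
    exact mul_mem (hv.1 _) (pow_mem hx i)
  have hinv : ∀ p : k[X], (aeval x p)⁻¹ ∈ v := fun p => by
    have hs := (IsAlgClosed.splits p).eq_prod_roots
    rw [hs, map_mul, map_multiset_prod, aeval_C, Multiset.map_map, mul_inv, ← map_inv₀]
    refine mul_mem (hv.1 _) ?_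
    rw [← Multiset.prod_map_inv]
    refine multiset_prod_mem _ fun z hz => ?_
    obtain ⟨c, _, rfl⟩ := Multiset.mem_map.1 hz
    simp only [Function.comp, map_sub, aeval_X, aeval_C]
    exact inv_mem_of_not_lt v (not_lt.2 (hno c))
  have hsub : ∀ z ∈ k⟮x⟯, z ∈ v := by
    intro z hz
    obtain ⟨r, s, rfl⟩ := (mem_adjoin_simple_iff k z).1 hz
    rw [div_eq_mul_inv]
    exact mul_mem (hmem r) (hinv s)
  apply hv.2
  rw [Set.eq_univ_iff_forall]
  intro z
  have hz : IsIntegral k⟮x⟯ z := Algebra.IsIntegral.isIntegral z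
  let φ : k⟮x⟯ →+* v :=
    { toFun := fun z => ⟨z, hsub z z.2⟩
      map_one' := rfl
      map_zero' := rfl
      map_mul' := fun _ _ => rfl
      map_add' := fun _ _ => rfl }
  have hz' : IsIntegral v z := by
    obtain ⟨p, hp, hp0⟩ := hz
    refine ⟨p.map φ, hp.map φ, ?_⟩
    rw [eval₂_map]
    exact hp0
  obtain ⟨w, hw⟩ := IsIntegrallyClosed.isIntegral_iff.1 hz'
  rw [← hw]
  exact w.2

theorem IsPl.eq_of_le [IsAlgClosed k]
    (hconst : ∀ x : K, IsAlgebraic k x → x ∈ (algebraMap k K).range)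
    (hfin : ∀ y : K, ¬ IsAlgebraic k y → FiniteDimensional k⟮y⟯ K)
    {v w : ValuationSubring K} (hv : IsPl k v) (hw : IsPl k w) (h : v ≤ w) : v = w := by
  apply le_antisymm h
  intro x hx
  obtain ⟨c, hc⟩ := hw.res hconst hfin hx
  have : v.valuation (x - algebraMap k K c) < 1 := by
    rw [lt_one_iff_inv] at hc ⊢
    exact fun h' => hc ⟨h'.1, h h'.2⟩
  have := add_mem ((v.valuation_le_one_iff _).1 this.le) (hv.1 c)
  simpa using this

/-- avoid finitely many values -/
theorem avoid [Infinite k] {T : Set (ValuationSubring K)} (hT : T.Finite)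
    (hP : ∀ v ∈ T, IsPl k v) (x : K) :
    ∃ c : k, c ≠ 0 ∧ ∀ v ∈ T, ¬ v.valuation (x - algebraMap k K c) < 1 := by
  have hfin : ({0} ∪ ⋃ v ∈ T, {c : k | v.valuation (x - algebraMap k K c) < 1}).Finite := by
    refine (Set.finite_singleton 0).union (hT.biUnion fun v hv => ?_)
    exact Set.Subsingleton.finite fun c hc c' hc' => (hP v hv).uniq hc hc'
  obtain ⟨c, hc⟩ := hfin.exists_notMem
  simp only [Set.mem_union, Set.mem_singleton_iff, Set.mem_iUnion, not_or, not_exists,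
    Set.mem_ofPred_eq] at hc
  exact ⟨c, hc.1, fun v hv => hc.2 v hv⟩

/-- separating two places, regular at all others -/
theorem sep2 [IsAlgClosed k]
    (hconst : ∀ x : K, IsAlgebraic k x → x ∈ (algebraMap k K).range)
    (hfin : ∀ y : K, ¬ IsAlgebraic k y → FiniteDimensional k⟮y⟯ K)
    {T : Set (ValuationSubring K)} (hT : T.Finite)
    (hP : ∀ v ∈ T, IsPl k v) {v w : ValuationSubring K} (hv : v ∈ T) (hw : w ∈ T) (hne : v ≠ w) :
    ∃ z : K, v.valuation z = 1 ∧ w.valuation z < 1 ∧ ∀ l ∈ T, l.valuation z ≤ 1 := by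
  have : Infinite k := IsAlgClosed.instInfinite
  obtain ⟨a, ha, ha'⟩ : ∃ a ∈ v, a ∉ w := by
    by_contra! h
    exact hne ((hP v hv).eq_of_le hconst hfin (hP w hw) h)
  obtain ⟨b, hb, hb'⟩ : ∃ b ∈ w, b ∉ v := by
    by_contra! h
    exact hne ((hP w hw).eq_of_le hconst hfin (hP v hv) h).symm
  rw [← ValuationSubring.valuation_le_one_iff] at ha ha' hb hb'
  rw [not_le] at ha' hb'
  have ha0 : a ≠ 0 := by
    rintro rfl
    simp at ha'
  have hx1 : 1 < v.valuation (b / a) := by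
    rw [map_div₀, one_lt_div₀ (zero_lt_iff.2 ((Valuation.ne_zero_iff _).2 ha0))]
    exact ha.trans_lt hb'
  have hx2 : w.valuation (b / a) < 1 := by
    rw [map_div₀, div_lt_one₀ (zero_lt_iff.2 ((Valuation.ne_zero_iff _).2 ha0))]
    exact hb.trans_lt ha'
  set x := b / a with hxdef
  obtain ⟨c, hc0, hc⟩ := avoid hT hP x
  -- valuation of the denominator at a pole of `x`
  have key : ∀ l ∈ T, 1 < l.valuation x →
      l.valuation (x - algebraMap k K c) = l.valuation x := fun l hl h => by
    apply Valuation.map_sub_eq_of_lt_left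
    rwa [(hP l hl).const hc0]
  refine ⟨x / (x - algebraMap k K c), ?_, ?_, ?_⟩
  · rw [map_div₀, key v hv hx1, div_self (zero_lt_one.trans hx1).ne']
  · rw [map_div₀, Valuation.map_sub_eq_of_lt_right, (hP w hw).const hc0, div_one]
    · exact hx2
    · rwa [(hP w hw).const hc0]
  · intro l hl
    rcases lt_or_ge 1 (l.valuation x) with h | h
    · rw [map_div₀, key l hl h, div_self (zero_lt_one.trans h).ne']
    · rw [map_div₀]
      exact (div_le_one₀ (zero_lt_one.trans_le (not_lt.1 (hc l hl)))).2
        (h.trans (not_lt.1 (hc l hl)))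

theorem sepAll [IsAlgClosed k]
    (hconst : ∀ x : K, IsAlgebraic k x → x ∈ (algebraMap k K).range)
    (hfin : ∀ y : K, ¬ IsAlgebraic k y → FiniteDimensional k⟮y⟯ K)
    (T : Finset (ValuationSubring K))
    (hP : ∀ v ∈ T, IsPl k v) {v : ValuationSubring K} (hv : v ∈ T) :
    ∃ z : K, v.valuation z = 1 ∧ ∀ w ∈ T, w ≠ v → w.valuation z < 1 := by
  classical
  have : ∀ w : ValuationSubring K, ∃ z : K, w ∈ T → w ≠ v →
      (v.valuation z = 1 ∧ w.valuation z < 1 ∧ ∀ l ∈ T, l.valuation z ≤ 1) := fun w => by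
    by_cases hw : w ∈ T ∧ w ≠ v
    · obtain ⟨z, hz⟩ := sep2 hconst hfin T.finite_toSet hP hv hw.1 hw.2.symm
      exact ⟨z, fun _ _ => hz⟩
    · exact ⟨0, fun h h' => (hw ⟨h, h'⟩).elim⟩
  choose z hz using this
  refine ⟨∏ w ∈ T.erase v, z w, ?_, ?_⟩
  · rw [map_prod]
    refine Finset.prod_eq_one fun w hw => ?_
    rw [Finset.mem_erase] at hw
    exact (hz w hw.2 hw.1).1
  · intro w hw hwv
    rw [← Finset.mul_prod_erase _ _ (Finset.mem_erase.2 ⟨hwv, hw⟩), map_mul]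
    refine mul_lt_one_of_lt_of_le (hz w hw hwv).2.1 ?_
    rw [map_prod]
    refine Finset.prod_le_one' fun l hl => ?_
    simp only [Finset.mem_erase] at hl
    exact (hz l hl.2.2 hl.2.1).2.2 w hw

/-- number of zeros is at most the degree -/
theorem zeros_le [IsAlgClosed k]
    (hconst : ∀ x : K, IsAlgebraic k x → x ∈ (algebraMap k K).range)
    (hfin : ∀ y : K, ¬ IsAlgebraic k y → FiniteDimensional k⟮y⟯ K)
    (T : Finset (ValuationSubring K))
    (hP : ∀ v ∈ T, IsPl k v) {g : K} (hg : ¬ IsAlgebraic k g)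
    (hgT : ∀ v ∈ T, v.valuation g < 1) : T.card ≤ Module.finrank k⟮g⟯ K := by
  classical
  have hfg := hfin g hg
  have hg0 : g ≠ 0 := by
    rintro rfl
    exact hg isAlgebraic_zero
  have : ∀ v : T, ∃ z : K, v.1.valuation z = 1 ∧ ∀ w ∈ T, w ≠ v.1 → w.valuation z < 1 :=
    fun v => sepAll hconst hfin T hP v.2
  choose z hz1 hz2 using this
  let := polyAlg (k := k) g
  have := polyAlg_frac hg
  let : Algebra k[X] K := (aeval g).toAlgebra
  have : IsScalarTower k[X] k⟮g⟯ K := IsScalarTower.of_algebraMap_eq fun p => by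
    exact (polyAlg_apply g p).symm
  have hle : ∀ v ∈ T, ∀ p : k[X], v.valuation (aeval g p) ≤ 1 := fun v hv p => by
    rw [v.valuation_le_one_iff, aeval_eq_sum_range]
    refine sum_mem fun i _ => ?_
    rw [Algebra.smul_def]
    exact mul_mem ((hP v hv).1 _) (pow_mem ((v.valuation_le_one_iff _).1 (hgT v hv).le) i)
  have step : ∀ p : T → k[X], ∑ v, aeval g (p v) * z v = 0 → ∀ v, X ∣ p v := by
    intro p hp v
    rw [X_dvd_iff]
    by_contra hne
    have e1 : v.1.valuation (aeval g (p v)) = 1 := by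
      rw [← divX_mul_X_add (p v), map_add, map_mul, aeval_X, aeval_C,
        Valuation.map_add_eq_of_lt_right, (hP v v.2).const hne]
      rw [(hP v v.2).const hne, map_mul]
      rw [mul_comm]
      exact mul_lt_one_of_lt_of_le (hgT v v.2) (hle v v.2 _)
    rw [← Finset.add_sum_erase _ _ (Finset.mem_univ v), add_eq_zero_iff_eq_neg] at hp
    have e2 : v.1.valuation (aeval g (p v) * z v) < 1 := by
      rw [hp, Valuation.map_neg]
      refine Valuation.map_sum_lt _ one_ne_zero fun w hw => ?_
      rw [map_mul, mul_comm]
      refine mul_lt_one_of_lt_of_le (hz2 w v v.2 ?_) (hle v v.2 _)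
      intro h
      exact (Finset.mem_erase.1 hw).1 (Subtype.ext h.symm)
    rw [map_mul, e1, hz1, one_mul] at e2
    exact lt_irrefl _ e2
  have stepn : ∀ n : ℕ, ∀ p : T → k[X], ∑ v, aeval g (p v) * z v = 0 → ∀ v, X ^ n ∣ p v := by
    intro n
    induction n with
    | zero => intro p _ v; simp
    | succ n ih =>
      intro p hp v
      choose q hq using step p hp
      have hq0 : ∑ v, aeval g (q v) * z v = 0 := by
        have : g * ∑ v, aeval g (q v) * z v = 0 := by
          rw [Finset.mul_sum, ← hp]
          refine Finset.sum_congr rfl fun v _ => ?_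
          rw [hq v, map_mul, aeval_X, mul_assoc]
        exact (mul_eq_zero.1 this).resolve_left hg0
      rw [hq v, pow_succ']
      exact mul_dvd_mul_left _ (ih q hq0 v)
  have hli : LinearIndependent k[X] z := by
    rw [Fintype.linearIndependent_iff]
    intro p hp v
    by_contra hne
    have := natDegree_le_of_dvd (stepn ((p v).natDegree + 1) p
      (by simp only [Algebra.smul_def] at hp; exact hp) v) hne
    rw [natDegree_X_pow] at this
    omega
  have := ((LinearIndependent.iff_fractionRing k[X] k⟮g⟯).1 hli).fintype_card_le_finrank
  simpa using this

end places

theorem stmt_0 (k K : Type) [Field k] [IsAlgClosed k] [Field K] [Algebra k K]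
    -- `k` is algebraically closed in `K` (the constants are exactly `k`):
    (hconst : ∀ x : K, IsAlgebraic k x → x ∈ (algebraMap k K).range)
    -- `K` has transcendence degree 1 and is a function field of one variable:
    (t : K) (ht : ¬ IsAlgebraic k t)
    (hfd : FiniteDimensional (IntermediateField.adjoin k {t}) K)
    -- a nontrivial automorphism `u` of the curve:
    (u : K ≃ₐ[k] K) (hu : u ≠ AlgEquiv.refl)
    -- a finite morphism `f : X → P¹` of degree `d`:
    (f : K) (hf : ¬ IsAlgebraic k f)
    (d : ℕ) (hd : d = Module.finrank (IntermediateField.adjoin k {f}) K)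
    -- the pullback `u*f` differs from `f`:
    (hne : u f ≠ f)
    -- `r` is the number of fixed points of `u`:
    (r : ℕ)
    (hr : r = Set.ncard {v : ValuationSubring K |
        (∀ c : k, algebraMap k K c ∈ v) ∧ (v : Set K) ≠ Set.univ ∧
        (∀ x : K, u x ∈ v ↔ x ∈ v)}) :
    r ≤ 2 * d := by
  have hfin : ∀ y : K, ¬ IsAlgebraic k y → FiniteDimensional k⟮y⟯ K := fun y hy =>
    fin_lem ht hfd hy
  set S := {v : ValuationSubring K |
        (∀ c : k, algebraMap k K c ∈ v) ∧ (v : Set K) ≠ Set.univ ∧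
        (∀ x : K, u x ∈ v ↔ x ∈ v)} with hS
  by_cases hSf : S.Finite
  swap
  · rw [Set.Infinite.ncard hSf] at hr
    omega
  rcases S.eq_empty_or_nonempty with hSe | ⟨v0, hv0⟩
  · rw [hSe, Set.ncard_empty] at hr
    omega
  have hP : ∀ v ∈ S, IsPl k v := fun v hv => ⟨hv.1, hv.2.1⟩
  have : Infinite k := IsAlgClosed.instInfinite
  obtain ⟨c, -, hc⟩ := avoid hSf hP f
  have hmem : (f - algebraMap k K c) ∈ k⟮f⟯ :=
    sub_mem (mem_adjoin_simple_self k f) (IntermediateField.algebraMap_mem _ c)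
  set a : K := (f - algebraMap k K c)⁻¹ with ha
  have hfa : f = a⁻¹ + algebraMap k K c := by simp [ha]
  have haf : k⟮a⟯ = k⟮f⟯ := by
    apply le_antisymm
    · rw [adjoin_simple_le_iff]
      exact inv_mem hmem
    · rw [adjoin_simple_le_iff]
      have h1 : a⁻¹ + algebraMap k K c ∈ k⟮a⟯ :=
        add_mem (inv_mem (mem_adjoin_simple_self k a)) (IntermediateField.algebraMap_mem _ c)
      rwa [← hfa] at h1
  have hat : ¬ IsAlgebraic k a := by
    intro h
    apply hf
    rw [hfa]
    exact h.inv.add (isAlgebraic_algebraMap c)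
  have hut : ¬ IsAlgebraic k (u a) := by
    intro h
    exact hat ((isAlgebraic_algHom_iff u.toAlgHom u.injective).1 h)
  have hua : u a ≠ a := by
    intro h
    apply hne
    rw [hfa, map_add, map_inv₀, h, AlgEquiv.commutes]
  have hzero : ∀ v ∈ S, v.valuation (u a - a) < 1 := by
    intro v hv
    have hav : a ∈ v := inv_mem_of_not_lt v (hc v hv)
    obtain ⟨e, he⟩ := (hP v hv).res hconst hfin hav
    have he2 : v.valuation (u a - algebraMap k K e) < 1 := by
      rw [lt_one_iff_inv] at he ⊢
      intro h
      apply he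
      have hu1 : u (a - algebraMap k K e) = u a - algebraMap k K e := by simp
      rw [← hu1, ← map_inv₀] at h
      exact ⟨fun h0 => h.1 (by rw [h0, map_zero]), (hv.2.2 _).1 h.2⟩
    have := Valuation.map_sub_lt _ he2 he
    rwa [sub_sub_sub_cancel_right] at this
  have hgt : ¬ IsAlgebraic k (u a - a) := by
    intro h
    obtain ⟨e, he⟩ := hconst _ h
    have hv := hzero v0 hv0
    have he0 : e ≠ 0 := by
      rintro rfl
      rw [map_zero] at he
      exact hua (sub_eq_zero.1 he.symm)
    rw [← he, (hP v0 hv0).const he0] at hv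
    exact lt_irrefl _ hv
  have hz := zeros_le hconst hfin hSf.toFinset (by simpa using hP) hgt (by simpa using hzero)
  have := hfin a hat
  have hdeg := deg_sub hat hut hgt (Algebra.IsAlgebraic.isAlgebraic (u a))
  rw [finrank_aut, haf, ← hd] at hdeg
  rw [hr, Set.ncard_eq_toFinset_card S hSf]
  omega
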